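/- For every integer g ≥ 1, there exists a unique ℂ-algebra automorphism ι of K with ι(x) = x⁻¹ and ι(y) = i·y·x^(−(g+1)) (where i ∈ ℂ is the imaginary unit), and the composition ι ∘ ι is the unique ℂ-algebra automorphism η of K with η(x) = x and η(y) = −y (the hyperelliptic involution). -/

import Mathlib

set_option synthInstance.maxHeartbeats 1000000
set_option maxHeartbeats 1000000

/-- The ideal `(Y² − X^(2g+1) + X)` in `ℂ[X, Y]`, where `X = X 0` and `Y = X 1`. -/
noncomputable def dipolarIdeal (g : ℕ) : Ideal (MvPolynomial (Fin 2) ℂ) :=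
  Ideal.span {MvPolynomial.X 1 ^ 2 - MvPolynomial.X 0 ^ (2 * g + 1) + MvPolynomial.X 0}

/-- The affine coordinate ring `A = ℂ[X, Y] / (Y² − X^(2g+1) + X)` of the dipolar curve. -/
abbrev DipolarA (g : ℕ) : Type := MvPolynomial (Fin 2) ℂ ⧸ dipolarIdeal g

/-- The function field `K`, the field of fractions of `A`. -/
abbrev DipolarK (g : ℕ) : Type := FractionRing (DipolarA g)

/-- The image `x` of `X` in `K`. -/
noncomputable def dx (g : ℕ) : DipolarK g :=
  algebraMap (DipolarA g) (DipolarK g) (Ideal.Quotient.mk (dipolarIdeal g) (MvPolynomial.X 0))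

/-- The image `y` of `Y` in `K`. -/
noncomputable def dy (g : ℕ) : DipolarK g :=
  algebraMap (DipolarA g) (DipolarK g) (Ideal.Quotient.mk (dipolarIdeal g) (MvPolynomial.X 1))

/-- Evaluation of polynomials at a pair of elements of `K`. -/
noncomputable def dipolarEval (g : ℕ) (u v : DipolarK g) :
    MvPolynomial (Fin 2) ℂ →ₐ[ℂ] DipolarK g :=
  MvPolynomial.aeval ![u, v]

@[simp] lemma dipolarEval_X_zero (g : ℕ) (u v : DipolarK g) :
    dipolarEval g u v (MvPolynomial.X 0) = u := by
  simp [dipolarEval]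

@[simp] lemma dipolarEval_X_one (g : ℕ) (u v : DipolarK g) :
    dipolarEval g u v (MvPolynomial.X 1) = v := by
  simp [dipolarEval]

lemma dipolarEval_dx_dy (g : ℕ) (p : MvPolynomial (Fin 2) ℂ) :
    dipolarEval g (dx g) (dy g) p =
      algebraMap (DipolarA g) (DipolarK g) (Ideal.Quotient.mk (dipolarIdeal g) p) := by
  have h : dipolarEval g (dx g) (dy g) =
      (IsScalarTower.toAlgHom ℂ (DipolarA g) (DipolarK g)).comp
        (Ideal.Quotient.mkₐ ℂ (dipolarIdeal g)) := by
    ext i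
    fin_cases i
    · simp [dx]
    · simp [dy]
  rw [h]
  rfl

lemma dipolarEval_dx_dy_eq_zero_iff (g : ℕ) (p : MvPolynomial (Fin 2) ℂ) :
    dipolarEval g (dx g) (dy g) p = 0 ↔ p ∈ dipolarIdeal g := by
  rw [dipolarEval_dx_dy, IsFractionRing.to_map_eq_zero_iff, Ideal.Quotient.eq_zero_iff_mem]

lemma dy_sq (g : ℕ) : dy g ^ 2 = dx g ^ (2 * g + 1) - dx g := by
  have h := (dipolarEval_dx_dy_eq_zero_iff g _).2
    (Ideal.subset_span (Set.mem_singleton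
      (MvPolynomial.X 1 ^ 2 - MvPolynomial.X 0 ^ (2 * g + 1) + MvPolynomial.X 0)))
  simp only [map_add, map_sub, map_pow, dipolarEval_X_zero, dipolarEval_X_one] at h
  linear_combination h

lemma dx_ne_zero (g : ℕ) : dx g ≠ 0 := by
  intro h
  have hX := (dipolarEval_dx_dy_eq_zero_iff g (MvPolynomial.X 0)).1 (by simpa using h)
  obtain ⟨s, hs⟩ := IsAlgClosed.exists_pow_nat_eq ((2 : ℂ) ^ (2 * g + 1) - 2) (n := 2) (by norm_num)
  have hle : dipolarIdeal g ≤ RingHom.ker (MvPolynomial.aeval (R := ℂ) ![(2 : ℂ), s]) := by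
    refine (Ideal.span_singleton_le_iff_mem _).2 ?_
    simp [RingHom.mem_ker, hs]
  have := hle hX
  simp [RingHom.mem_ker] at this

lemma dipolarEval_eq_zero_of_mem (g : ℕ) {u v : DipolarK g}
    (h : v ^ 2 = u ^ (2 * g + 1) - u) {p : MvPolynomial (Fin 2) ℂ} (hp : p ∈ dipolarIdeal g) :
    dipolarEval g u v p = 0 := by
  have hle : dipolarIdeal g ≤ RingHom.ker (dipolarEval g u v) := by
    refine (Ideal.span_singleton_le_iff_mem _).2 ?_
    simp [RingHom.mem_ker, h]
  exact hle hp

/-- A point of the curve with values in `K` that satisfies no further algebraic relation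
defines an endomorphism of `K`. -/
lemma exists_dipolarK_algHom (g : ℕ) [IsDomain (DipolarA g)] {u v : DipolarK g}
    (h : v ^ 2 = u ^ (2 * g + 1) - u)
    (hinj : ∀ p, dipolarEval g u v p = 0 → dipolarEval g (dx g) (dy g) p = 0) :
    ∃ f : DipolarK g →ₐ[ℂ] DipolarK g, f (dx g) = u ∧ f (dy g) = v := by
  let φ : DipolarA g →ₐ[ℂ] DipolarK g :=
    Ideal.Quotient.liftₐ (dipolarIdeal g) (dipolarEval g u v)
      fun _ hp => dipolarEval_eq_zero_of_mem g h hp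
  have hφ : ∀ p, φ (Ideal.Quotient.mk (dipolarIdeal g) p) = dipolarEval g u v p := fun _ => rfl
  have hφinj : Function.Injective φ := by
    rw [injective_iff_map_eq_zero]
    intro a ha
    obtain ⟨p, rfl⟩ := Ideal.Quotient.mk_surjective a
    rw [hφ] at ha
    exact Ideal.Quotient.eq_zero_iff_mem.2 ((dipolarEval_dx_dy_eq_zero_iff g p).1 (hinj p ha))
  refine ⟨IsFractionRing.liftAlgHom (K := DipolarK g) hφinj, ?_, ?_⟩
  · rw [dx, IsFractionRing.liftAlgHom_apply, IsFractionRing.lift_algebraMap]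
    exact (hφ _).trans (dipolarEval_X_zero g u v)
  · rw [dy, IsFractionRing.liftAlgHom_apply, IsFractionRing.lift_algebraMap]
    exact (hφ _).trans (dipolarEval_X_one g u v)

lemma dipolarK_algHom_ext (g : ℕ) [IsDomain (DipolarA g)] {f f' : DipolarK g →ₐ[ℂ] DipolarK g}
    (hx : f (dx g) = f' (dx g)) (hy : f (dy g) = f' (dy g)) : f = f' := by
  have h : f.comp (dipolarEval g (dx g) (dy g)) = f'.comp (dipolarEval g (dx g) (dy g)) := by
    ext i
    fin_cases i
    · simpa using hx
    · simpa using hy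
  ext a
  obtain ⟨p, rfl⟩ := Ideal.Quotient.mk_surjective a
  have hp := DFunLike.congr_fun h p
  simp only [AlgHom.comp_apply, dipolarEval_dx_dy] at hp
  exact hp

lemma dipolarEval_neg_eq_zero (g : ℕ) [IsDomain (DipolarA g)] (p : MvPolynomial (Fin 2) ℂ)
    (hp : dipolarEval g (dx g) (-dy g) p = 0) : dipolarEval g (dx g) (dy g) p = 0 := by
  let σ : MvPolynomial (Fin 2) ℂ →ₐ[ℂ] MvPolynomial (Fin 2) ℂ :=
    MvPolynomial.aeval ![MvPolynomial.X 0, -MvPolynomial.X 1]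
  have hσ : ∀ v, (dipolarEval g (dx g) v).comp σ = dipolarEval g (dx g) (-v) := by
    intro v
    ext i
    fin_cases i <;> simp [σ]
  have hmem : σ p ∈ dipolarIdeal g := by
    rw [← dipolarEval_dx_dy_eq_zero_iff, ← hp, ← hσ]
    rfl
  have h := dipolarEval_eq_zero_of_mem g (u := dx g) (v := -dy g) (by rw [neg_sq, dy_sq]) hmem
  rw [← neg_neg (dy g), ← hσ]
  exact h

lemma algebraMap_I_sq (g : ℕ) [IsDomain (DipolarA g)] :
    algebraMap ℂ (DipolarK g) Complex.I ^ 2 = -1 := by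
  rw [← map_pow, Complex.I_sq, map_neg, map_one]

/-- Up to a power of `x`, evaluation at the image of `(x, y)` under `ι` lands in `A`, and iterating
it gives evaluation at `(x, -y)`. -/
lemma exists_pow_mul_dipolarEval_inv (g : ℕ) [IsDomain (DipolarA g)]
    (p : MvPolynomial (Fin 2) ℂ) {v : DipolarK g}
    (hv : v = algebraMap ℂ (DipolarK g) Complex.I * dy g * (dx g)⁻¹ ^ (g + 1)) :
    ∃ (n : ℕ) (q : MvPolynomial (Fin 2) ℂ),
      dipolarEval g (dx g) (dy g) q = dx g ^ n * dipolarEval g (dx g)⁻¹ v p ∧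
      dx g ^ n * dipolarEval g (dx g)⁻¹ v q = dipolarEval g (dx g) (-dy g) p := by
  have hx := dx_ne_zero g
  induction p using MvPolynomial.induction_on with
  | C a => exact ⟨0, MvPolynomial.C a, by simp [dipolarEval], by simp [dipolarEval]⟩
  | add p₁ p₂ h₁ h₂ =>
    obtain ⟨n, q₁, h₁, h₁'⟩ := h₁
    obtain ⟨m, q₂, h₂, h₂'⟩ := h₂
    refine ⟨n + m, MvPolynomial.X 0 ^ m * q₁ + MvPolynomial.X 0 ^ n * q₂, ?_, ?_⟩
    · simp only [map_add, map_mul, map_pow, dipolarEval_X_zero, h₁, h₂]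
      ring
    · simp only [map_add, map_mul, map_pow, dipolarEval_X_zero, ← h₁', ← h₂', inv_pow]
      generalize dipolarEval g (dx g)⁻¹ v q₁ = w₁
      generalize dipolarEval g (dx g)⁻¹ v q₂ = w₂
      field_simp
      ring
  | mul_X p i h =>
    obtain ⟨n, q, h, h'⟩ := h
    fin_cases i
    · refine ⟨n + 1, q, ?_, ?_⟩
      · simp only [map_mul, h, Fin.zero_eta, dipolarEval_X_zero]
        generalize dipolarEval g (dx g)⁻¹ v p = w
        field_simp
        ring
      · simp [← h']
        ring
    · refine ⟨n + (g + 1), MvPolynomial.C Complex.I * MvPolynomial.X 1 * q, ?_, ?_⟩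
      · have hC : dipolarEval g (dx g) (dy g) (MvPolynomial.C Complex.I) =
            algebraMap ℂ (DipolarK g) Complex.I := by simp [dipolarEval]
        simp only [map_mul, h, hC, Fin.mk_one, dipolarEval_X_one]
        generalize dipolarEval g (dx g)⁻¹ v p = w
        rw [hv, inv_pow]
        field_simp
        ring
      · have hC : dipolarEval g (dx g)⁻¹ v (MvPolynomial.C Complex.I) =
            algebraMap ℂ (DipolarK g) Complex.I := by simp [dipolarEval]
        have hpow : dx g ^ (g + 1) * (dx g)⁻¹ ^ (g + 1) = 1 := by
          rw [← mul_pow, mul_inv_cancel₀ hx, one_pow]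
        simp only [map_mul, ← h', hC, Fin.mk_one, dipolarEval_X_one]
        generalize dipolarEval g (dx g)⁻¹ v q = w
        rw [hv, pow_add]
        linear_combination (dx g ^ n * w * dy g) *
          (algebraMap ℂ (DipolarK g) Complex.I ^ 2 * hpow + algebraMap_I_sq g)

/-- The square of an endomorphism acting as `ι` on `x` and `y` acts as `η`. -/
lemma dipolar_apply_apply (g : ℕ) [IsDomain (DipolarA g)] {f : DipolarK g →ₐ[ℂ] DipolarK g}
    (hx : f (dx g) = (dx g)⁻¹)
    (hy : f (dy g) = algebraMap ℂ (DipolarK g) Complex.I * dy g * dx g ^ (-(g + 1 : ℤ))) :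
    f (f (dx g)) = dx g ∧ f (f (dy g)) = -dy g := by
  refine ⟨by rw [hx, map_inv₀, hx, inv_inv], ?_⟩
  have hpow : (dx g)⁻¹ ^ (-(g + 1 : ℤ)) * dx g ^ (-(g + 1 : ℤ)) = 1 := by
    rw [← mul_zpow, inv_mul_cancel₀ (dx_ne_zero g), one_zpow]
  rw [hy, map_mul, map_mul, map_zpow₀, AlgHom.commutes, hx, hy]
  linear_combination dy g *
    (algebraMap ℂ (DipolarK g) Complex.I ^ 2 * hpow + algebraMap_I_sq g)

lemma dipolarK_algEquiv_ext (g : ℕ) [IsDomain (DipolarA g)] {f f' : DipolarK g ≃ₐ[ℂ] DipolarK g}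
    (hx : f (dx g) = f' (dx g)) (hy : f (dy g) = f' (dy g)) : f = f' :=
  AlgEquiv.coe_toAlgHom_injective (dipolarK_algHom_ext g (f := f) (f' := f') hx hy)

/-- For every `g ≥ 1`, there is a unique `ℂ`-algebra automorphism `ι` of `K` with
`ι(x) = x⁻¹` and `ι(y) = i·y·x^(−(g+1))`, there is a unique `ℂ`-algebra automorphism `η`
of `K` with `η(x) = x` and `η(y) = −y` (the hyperelliptic involution), and `ι ∘ ι = η`. -/
theorem dipolar_extra_automorphism (g : ℕ) (hg : 1 ≤ g) [IsDomain (DipolarA g)] :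
    (∃! ι : DipolarK g ≃ₐ[ℂ] DipolarK g,
        ι (dx g) = (dx g)⁻¹ ∧
          ι (dy g) = algebraMap ℂ (DipolarK g) Complex.I * dy g * dx g ^ (-(g + 1 : ℤ))) ∧
    (∃! η : DipolarK g ≃ₐ[ℂ] DipolarK g, η (dx g) = dx g ∧ η (dy g) = -dy g) ∧
    (∀ ι η : DipolarK g ≃ₐ[ℂ] DipolarK g,
        (ι (dx g) = (dx g)⁻¹ ∧
          ι (dy g) = algebraMap ℂ (DipolarK g) Complex.I * dy g * dx g ^ (-(g + 1 : ℤ))) →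
        (η (dx g) = dx g ∧ η (dy g) = -dy g) →
        ∀ z : DipolarK g, ι (ι z) = η z) := by
  have hη : ∃ η : DipolarK g →ₐ[ℂ] DipolarK g, η (dx g) = dx g ∧ η (dy g) = -dy g :=
    exists_dipolarK_algHom g (by rw [neg_sq, dy_sq]) (dipolarEval_neg_eq_zero g)
  have hι : ∃ ι : DipolarK g →ₐ[ℂ] DipolarK g, ι (dx g) = (dx g)⁻¹ ∧
      ι (dy g) = algebraMap ℂ (DipolarK g) Complex.I * dy g * dx g ^ (-(g + 1 : ℤ)) := by
    have hz : dx g ^ (-(g + 1 : ℤ)) = (dx g)⁻¹ ^ (g + 1) := by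
      rw [zpow_neg, inv_pow]
      norm_cast
    have hx := dx_ne_zero g
    have hrel : (algebraMap ℂ (DipolarK g) Complex.I * dy g * dx g ^ (-(g + 1 : ℤ))) ^ 2 =
        (dx g)⁻¹ ^ (2 * g + 1) - (dx g)⁻¹ := by
      rw [hz, mul_pow, mul_pow, algebraMap_I_sq, dy_sq]
      simp only [inv_pow]
      field_simp
      ring
    refine exists_dipolarK_algHom g hrel fun p hp => ?_
    obtain ⟨n, q, h, h'⟩ := exists_pow_mul_dipolarEval_inv g p (congrArg _ hz)
    rw [hp, mul_zero, dipolarEval_dx_dy_eq_zero_iff] at h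
    rw [dipolarEval_eq_zero_of_mem g hrel h, mul_zero] at h'
    exact dipolarEval_neg_eq_zero g p h'.symm
  obtain ⟨η, hηx, hηy⟩ := hη
  obtain ⟨ι, hιx, hιy⟩ := hι
  obtain ⟨hsx, hsy⟩ := dipolar_apply_apply g hιx hιy
  have hηη : η.comp η = AlgHom.id ℂ (DipolarK g) :=
    dipolarK_algHom_ext g (by simp [hηx]) (by simp [hηy])
  have hιι : ι.comp ι = η :=
    dipolarK_algHom_ext g (hsx.trans hηx.symm) (hsy.trans hηy.symm)
  have hηbij : Function.Bijective η :=
    Function.Involutive.bijective fun z => DFunLike.congr_fun hηη z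
  have hιbij : Function.Bijective ι := by
    refine ⟨ι.toRingHom.injective, fun z => ?_⟩
    obtain ⟨w, rfl⟩ := hηbij.surjective z
    exact ⟨ι w, DFunLike.congr_fun hιι w⟩
  refine ⟨⟨AlgEquiv.ofBijective ι hιbij, ⟨hιx, hιy⟩, fun f hf => ?_⟩,
    ⟨AlgEquiv.ofBijective η hηbij, ⟨hηx, hηy⟩, fun f hf => ?_⟩, fun f f' hf hf' z => ?_⟩
  · exact dipolarK_algEquiv_ext g (hf.1.trans hιx.symm) (hf.2.trans hιy.symm)
  · exact dipolarK_algEquiv_ext g (hf.1.trans hηx.symm) (hf.2.trans hηy.symm)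
  · obtain ⟨hfx, hfy⟩ := dipolar_apply_apply g (f := (f : DipolarK g →ₐ[ℂ] DipolarK g)) hf.1 hf.2
    exact DFunLike.congr_fun (dipolarK_algEquiv_ext g (f := f.trans f) (f' := f')
      (hfx.trans hf'.1.symm) (hfy.trans hf'.2.symm)) z
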